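/- Let α be a zero-sum-free sequence of length n over the cyclic group of order m. If n > m/2, then some group element appears in α with multiplicity at least 2n − m + 1. -/

import Mathlib

/-- The set of all subsequence sums of a list (including the sum 0 of the empty
subsequence). -/
def subSums {G : Type*} [AddCommMonoid G] [DecidableEq G] (l : List G) : Finset G :=
  (l.sublists.map List.sum).toFinset

/-- A sequence is zero-sum-free if no nonempty subsequence sums to zero. -/
def ZeroSumFree {G : Type*} [AddCommMonoid G] (l : List G) : Prop :=
  ∀ t : List G, t.Sublist l → t ≠ [] → t.sum ≠ 0

open scoped Pointwise in
/-- **Scherk's theorem**: if `0 ∈ A ∩ B` and `0 = a + b` has only the trivial solution in `A × B`,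
then `|A| + |B| ≤ |A + B| + 1`. -/
theorem card_add_card_le_card_add_of_unique_zero {G : Type*} [AddCommGroup G] [Finite G]
    [DecidableEq G] (A B : Finset G) (hA : 0 ∈ A) (hB : 0 ∈ B)
    (h : ∀ a ∈ A, ∀ b ∈ B, a + b = 0 → a = 0 ∧ b = 0) :
    A.card + B.card ≤ (A + B).card + 1 := by
  induction hk : B.card using Nat.strong_induction_on generalizing A B with
  | _ k ih =>
  subst hk
  by_cases hB0 : B = {0}
  · subst hB0
    simp
  obtain ⟨b, hb, hb0⟩ : ∃ b ∈ B, b ≠ 0 := by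
    by_contra! hall
    exact hB0 (Finset.eq_singleton_iff_unique_mem.2 ⟨hB, hall⟩)
  obtain ⟨a, ha, c, hc, hac⟩ : ∃ a ∈ A, ∃ c ∈ B, a + c ∉ A := by
    by_contra! hall
    have hmul : ∀ n : ℕ, n • b ∈ A := by
      intro n
      induction n with
      | zero => simpa using hA
      | succ n hn => rw [succ_nsmul]; exact hall _ hn _ hb
    have hpos := addOrderOf_pos b
    have hz : (addOrderOf b - 1) • b + b = 0 := by
      rw [← succ_nsmul, Nat.sub_add_cancel hpos, addOrderOf_nsmul_eq_zero]
    exact hb0 (h _ (hmul _) _ hb hz).2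
  set C := B.image (a + ·) with hC
  set B' := B.filter (fun x => a + x ∈ A) with hB'
  have hCcard : C.card = B.card := Finset.card_image_of_injective _ (add_right_injective a)
  have hinter : (A ∩ C).card = B'.card := by
    rw [← Finset.card_image_of_injective B' (add_right_injective a)]
    congr 1
    ext x
    simp only [hC, hB', Finset.mem_inter, Finset.mem_image, Finset.mem_filter]
    constructor
    · rintro ⟨hx, y, hy, rfl⟩
      exact ⟨y, ⟨hy, hx⟩, rfl⟩
    · rintro ⟨y, ⟨hy, hx⟩, rfl⟩
      exact ⟨hx, y, hy, rfl⟩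
  have hlt : B'.card < B.card :=
    Finset.card_lt_card (Finset.filter_ssubset.2 ⟨c, hc, hac⟩)
  have hsub : (A ∪ C) + B' ⊆ A + B := by
    intro x hx
    obtain ⟨y, hy, z, hz, rfl⟩ := Finset.mem_add.1 hx
    obtain ⟨hzB, hzA⟩ := Finset.mem_filter.1 hz
    rcases Finset.mem_union.1 hy with hy | hy
    · exact Finset.add_mem_add hy hzB
    · obtain ⟨w, hw, rfl⟩ := Finset.mem_image.1 hy
      rw [add_right_comm]
      exact Finset.add_mem_add hzA hw
  have key := ih B'.card hlt (A ∪ C) B' (Finset.mem_union_left _ hA)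
    (Finset.mem_filter.2 ⟨hB, by simpa using ha⟩) (by
      intro y hy z hz hyz
      obtain ⟨hzB, hzA⟩ := Finset.mem_filter.1 hz
      rcases Finset.mem_union.1 hy with hy | hy
      · exact h y hy z hzB hyz
      · obtain ⟨w, hw, rfl⟩ := Finset.mem_image.1 hy
        obtain ⟨h1, rfl⟩ := h _ hzA w hw (by rw [← hyz]; abel)
        obtain ⟨rfl, rfl⟩ := h a ha z hzB h1
        simp) rfl
  have hun := Finset.card_union_add_card_inter A C
  have := Finset.card_le_card hsub
  omega

/-- The sums of all submultisets of `s`, including the empty one. -/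
def Multiset.subsetSums {G : Type*} [AddCommMonoid G] [DecidableEq G] (s : Multiset G) :
    Finset G :=
  (s.powerset.map Multiset.sum).toFinset

theorem Multiset.mem_subsetSums {G : Type*} [AddCommMonoid G] [DecidableEq G] {s : Multiset G}
    {x : G} : x ∈ s.subsetSums ↔ ∃ t ≤ s, t.sum = x := by
  simp [Multiset.subsetSums]

open scoped Pointwise in
theorem Multiset.subsetSums_add {G : Type*} [AddCommMonoid G] [DecidableEq G]
    (s t : Multiset G) : s.subsetSums + t.subsetSums ⊆ (s + t).subsetSums := by
  intro x hx
  obtain ⟨y, hy, z, hz, rfl⟩ := Finset.mem_add.1 hx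
  obtain ⟨u, hu, rfl⟩ := Multiset.mem_subsetSums.1 hy
  obtain ⟨v, hv, rfl⟩ := Multiset.mem_subsetSums.1 hz
  exact Multiset.mem_subsetSums.2 ⟨u + v, add_le_add hu hv, Multiset.sum_add u v⟩

/-- No nonempty submultiset of `s` sums to zero. -/
def Multiset.ZeroSumFree {G : Type*} [AddCommMonoid G] (s : Multiset G) : Prop :=
  ∀ t ≤ s, t.sum = 0 → t = 0

theorem Multiset.ZeroSumFree.mono {G : Type*} [AddCommMonoid G] {s t : Multiset G}
    (hs : s.ZeroSumFree) (h : t ≤ s) : t.ZeroSumFree :=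
  fun u hu => hs u (hu.trans h)

theorem Multiset.ZeroSumFree.card_subsetSums_add_le {G : Type*} [AddCommGroup G] [Finite G]
    [DecidableEq G] {s t : Multiset G} (h : (s + t).ZeroSumFree) :
    s.subsetSums.card + t.subsetSums.card ≤ (s + t).subsetSums.card + 1 := by
  have hzero (u : Multiset G) : 0 ∈ u.subsetSums :=
    Multiset.mem_subsetSums.2 ⟨0, Multiset.zero_le _, Multiset.sum_zero⟩
  refine (card_add_card_le_card_add_of_unique_zero _ _ (hzero s) (hzero t) ?_).trans
    (Nat.add_le_add_right (Finset.card_le_card (Multiset.subsetSums_add s t)) 1)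
  intro x hx y hy hxy
  obtain ⟨u, hu, rfl⟩ := Multiset.mem_subsetSums.1 hx
  obtain ⟨v, hv, rfl⟩ := Multiset.mem_subsetSums.1 hy
  have huv := h (u + v) (add_le_add hu hv) (by rw [Multiset.sum_add, hxy])
  obtain ⟨rfl, rfl⟩ := add_eq_zero.1 huv
  simp

theorem IsAddCyclic.card_filter_two_nsmul_eq_le {G : Type*} [AddCommGroup G] [Finite G]
    [DecidableEq G] [IsAddCyclic G] (A : Finset G) (T : G) :
    (A.filter (fun a => 2 • a = T)).card ≤ 2 := by
  have := Fintype.ofFinite G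
  rcases (A.filter (fun a => 2 • a = T)).eq_empty_or_nonempty with h | ⟨a, ha⟩
  · simp [h]
  rw [← Finset.card_image_of_injective _ (sub_left_injective (b := a))]
  refine le_trans (Finset.card_le_card fun x hx => ?_)
    (IsAddCyclic.card_nsmul_eq_zero_le (α := G) (n := 2) two_pos)
  obtain ⟨y, hy, rfl⟩ := Finset.mem_image.1 hx
  simp [nsmul_sub, (Finset.mem_filter.1 hy).2, (Finset.mem_filter.1 ha).2]

/-- A zero-sum-free set `A` in a cyclic group has at least `2|A|` subset sums: the elements `a` of
`A` and the sums `∑ A - a` overlap at most twice, and miss both `0` and `∑ A`. -/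
theorem Finset.two_mul_card_le_card_subsetSums {G : Type*} [AddCommGroup G] [Finite G]
    [DecidableEq G] [IsAddCyclic G] (A : Finset G) (hA : A.Nonempty)
    (h : A.val.ZeroSumFree) : 2 * A.card ≤ A.val.subsetSums.card := by
  have hmem : ∀ B ⊆ A, ∑ x ∈ B, x ∈ A.val.subsetSums := fun B hB =>
    Multiset.mem_subsetSums.2 ⟨B.val, Finset.val_le_iff.2 hB, Finset.sum_val B⟩
  have hne : ∀ B ⊆ A, B.Nonempty → ∑ x ∈ B, x ≠ 0 := fun B hB hBn h0 =>
    hBn.ne_empty (Finset.val_eq_zero.1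
      (h B.val (Finset.val_le_iff.2 hB) ((Finset.sum_val B).trans h0)))
  set T := ∑ x ∈ A, x with hT
  have hT0 : T ≠ 0 := hne A subset_rfl hA
  have herase : ∀ a ∈ A, ∑ x ∈ A.erase a, x = T - a := fun a ha =>
    eq_sub_of_add_eq (Finset.sum_erase_add A _ ha)
  have hA0 : ∀ a ∈ A, a ≠ 0 := fun a ha => by
    simpa using hne {a} (by simpa using ha) (by simp)
  have h0mem : (0 : G) ∈ A.val.subsetSums := by simpa using hmem ∅ (by simp)
  have hTmem : T ∈ A.val.subsetSums := hmem A subset_rfl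
  have hpair : ({0, T} : Finset G).card = 2 := Finset.card_pair hT0.symm
  rcases Nat.lt_or_ge A.card 2 with hk | hk
  · have := Finset.card_le_card (s := {0, T}) (t := A.val.subsetSums) (by
      simp [Finset.insert_subset_iff, h0mem, hTmem])
    omega
  have hTa : ∀ a ∈ A, T - a ≠ 0 := fun a ha => by
    rw [← herase a ha]
    exact hne _ (Finset.erase_subset _ _) (Finset.card_pos.1 (by
      rw [Finset.card_erase_of_mem ha]; omega))
  set Y := A.image (T - ·) with hY
  have hYcard : Y.card = A.card := Finset.card_image_of_injective _ (sub_right_injective)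
  have hinter : (A ∩ Y).card ≤ 2 := by
    rcases hk.eq_or_lt with hk | hk
    · exact (Finset.card_le_card Finset.inter_subset_left).trans hk.ge
    refine (Finset.card_le_card fun x hx => ?_).trans
      (IsAddCyclic.card_filter_two_nsmul_eq_le A T)
    obtain ⟨hxA, hxY⟩ := Finset.mem_inter.1 hx
    obtain ⟨y, hy, hyx⟩ := Finset.mem_image.1 hxY
    refine Finset.mem_filter.2 ⟨hxA, ?_⟩
    have hyx' : T - y = x := hyx
    by_cases hxy : x = y
    · subst hxy
      rw [two_nsmul, ← eq_sub_iff_add_eq, hyx']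
    · exfalso
      have hxe : x ∈ A.erase y := Finset.mem_erase.2 ⟨hxy, hxA⟩
      refine hne ((A.erase y).erase x)
        ((Finset.erase_subset _ _).trans (Finset.erase_subset _ _)) (Finset.card_pos.1 ?_) ?_
      · rw [Finset.card_erase_of_mem hxe, Finset.card_erase_of_mem hy]; omega
      · rw [Finset.sum_erase_eq_sub hxe, herase y hy, hyx', sub_self]
  have hdisj : Disjoint (A ∪ Y) {0, T} := by
    rw [Finset.disjoint_right]
    intro x hx hxU
    rw [Finset.mem_insert, Finset.mem_singleton] at hx
    rcases Finset.mem_union.1 hxU with hxA | hxY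
    · rcases hx with rfl | rfl
      · exact hA0 _ hxA rfl
      · exact hTa _ hxA (sub_self _)
    · obtain ⟨y, hy, hyx⟩ := Finset.mem_image.1 hxY
      rcases hx with rfl | rfl
      · exact hTa y hy hyx
      · exact hA0 y hy (sub_eq_self.1 hyx)
  have hsub : (A ∪ Y) ∪ {0, T} ⊆ A.val.subsetSums := by
    refine Finset.union_subset (Finset.union_subset (fun a ha => ?_) fun x hx => ?_) ?_
    · simpa using hmem {a} (by simpa using ha)
    · obtain ⟨a, ha, rfl⟩ := Finset.mem_image.1 hx
      simpa only [herase a ha] using hmem _ (Finset.erase_subset a A)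
    · simp [Finset.insert_subset_iff, h0mem, hTmem]
  have h1 := Finset.card_le_card hsub
  rw [Finset.card_union_of_disjoint hdisj] at h1
  have h2 := Finset.card_union_add_card_inter A Y
  omega

/-- A zero-sum-free sequence in a cyclic group whose multiplicities are at most `k` splits into `k`
sets, and hence has at least `2|s| + 1 - k` subset sums. -/
theorem Multiset.ZeroSumFree.two_mul_card_lt {G : Type*} [AddCommGroup G] [Finite G]
    [DecidableEq G] [IsAddCyclic G] (k : ℕ) (s : Multiset G) (hs : s.ZeroSumFree)
    (hk : ∀ g, s.count g ≤ k) : 2 * s.card + 1 ≤ s.subsetSums.card + k := by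
  induction k generalizing s with
  | zero =>
    obtain rfl : s = 0 := Multiset.eq_zero_of_forall_notMem fun g hg =>
      (Multiset.count_pos.2 hg).ne' (Nat.le_zero.1 (hk g))
    simp [Multiset.subsetSums]
  | succ k ih =>
    rcases eq_or_ne s 0 with rfl | hs0
    · simp [Multiset.subsetSums]
    have hsplit : s.toFinset.val + (s - s.toFinset.val) = s :=
      add_tsub_cancel_of_le (by simpa using Multiset.dedup_le s)
    have hrest := ih (s - s.toFinset.val) (hs.mono tsub_le_self) fun g => by
      have hg := hk g
      rw [Multiset.count_sub, Multiset.toFinset_val, Multiset.count_dedup]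
      split_ifs with hmem
      · omega
      · simp [Multiset.count_eq_zero_of_notMem hmem]
    have hset := Finset.two_mul_card_le_card_subsetSums s.toFinset
      (by simpa using hs0) (hs.mono (by simpa using Multiset.dedup_le s))
    have hadd := Multiset.ZeroSumFree.card_subsetSums_add_le (s := s.toFinset.val)
      (t := s - s.toFinset.val) (by rwa [hsplit])
    have hcard := congrArg Multiset.card hsplit
    rw [Multiset.card_add, Finset.card_val] at hcard
    rw [hsplit] at hadd
    omega

theorem ZeroSumFree.coe_multiset {G : Type*} [AddCommMonoid G] {l : List G}
    (h : ZeroSumFree l) : (l : Multiset G).ZeroSumFree := by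
  intro t ht h0
  induction t using Quotient.inductionOn with
  | _ t =>
  obtain ⟨u, hu, hul⟩ := Multiset.coe_le.1 ht
  by_contra hne
  refine h u hul ?_ (hu.sum_eq.trans (by simpa using h0))
  rintro rfl
  exact hne (by simpa using hu.symm.eq_nil)

/-- **Theorem (Bovey–Erdős–Niven).** If `α` is a zero-sum-free sequence of length `n`
over the cyclic group of order `m` with `n > m/2`, then some group element appears in
`α` with multiplicity at least `2n − m + 1` (stated in the subtraction-free form
`μ + m ≥ 2n + 1`). -/
theorem bovey_erdos_niven (m : ℕ) (hm : 0 < m) (l : List (ZMod m))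
    (hzsf : ZeroSumFree l) (hn : m < 2 * l.length) :
    ∃ g : ZMod m, 2 * l.length + 1 ≤ l.count g + m := by
  have : NeZero m := ⟨hm.ne'⟩
  by_contra! hlt
  have hbound := hzsf.coe_multiset.two_mul_card_lt (2 * l.length - m) (l : Multiset (ZMod m))
    fun g => by
      have := hlt g
      rw [Multiset.coe_count]
      omega
  have hle := Finset.card_le_univ (l : Multiset (ZMod m)).subsetSums
  rw [ZMod.card] at hle
  rw [Multiset.coe_card] at hbound
  omega
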